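/- Let D be a total dissipator on M_d(ℂ) built from jump operators L_1,…,L_m, let H_0 ∈ M_d(ℂ) be Hermitian, and let V : ℝ → M_d(ℂ) be a function with each V(t) Hermitian and continuous entries. Suppose the constant Lindbladian x ↦ −i[H_0, x] + D(x) is exponentially contractive with constants K > 0 and γ > 0. If sup_{t ≥ 0} ‖V(t)‖_∞ < γ / (2 + 2·ln K), where ‖·‖_∞ denotes the operator norm, then the driven Lindbladian L_t(x) = −i[H_0 + V(t), x] + D(x) is exponentially contractive (there exist K', γ' > 0 realizing the contraction bound). -/

import Mathlib

open scoped ComplexOrder Kronecker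
open Matrix

namespace Paper

variable {n : Type*} [Fintype n] [DecidableEq n]

/-- Trace norm: sum of singular values. -/
noncomputable def traceNorm (A : Matrix n n ℂ) : ℝ :=
  ∑ i, Real.sqrt ((Matrix.posSemidef_conjTranspose_mul_self A).isHermitian.eigenvalues i)

/-- The dissipator associated with a single jump operator. -/
noncomputable def dissipator (L x : Matrix n n ℂ) : Matrix n n ℂ :=
  L * x * Lᴴ - ((1 : ℂ)/2) • (Lᴴ * L * x + x * (Lᴴ * L))

/-- Total dissipator of a family of jump operators. -/
noncomputable def totalDissipator {m : ℕ} (L : Fin m → Matrix n n ℂ) (x : Matrix n n ℂ) :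
    Matrix n n ℂ :=
  ∑ j, dissipator (L j) x

/-- The Hamiltonian commutator term `-i[H, x]`. -/
noncomputable def hamTerm (H x : Matrix n n ℂ) : Matrix n n ℂ :=
  (-Complex.I) • (H * x - x * H)

/-- A solution of the master equation `ρ' = L_t(ρ)` starting at time `s`
(differentiable entrywise). -/
def IsSolution (Lt : ℝ → Matrix n n ℂ → Matrix n n ℂ) (s : ℝ) (ρ : ℝ → Matrix n n ℂ) : Prop :=
  ∀ t, s ≤ t → ∀ i j, HasDerivAt (fun u => ρ u i j) ((Lt t (ρ t)) i j) t

/-- Density matrix: Hermitian, positive semidefinite, trace one. -/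
def IsDensity (ρ : Matrix n n ℂ) : Prop := ρ.PosSemidef ∧ ρ.trace = 1

/-- Exponential contractivity with constants `K, γ` of a time-dependent Lindbladian. -/
def ExpContractiveWith (Lt : ℝ → Matrix n n ℂ → Matrix n n ℂ) (K γ : ℝ) : Prop :=
  ∀ s t : ℝ, 0 ≤ s → s ≤ t → ∀ ρ σ : ℝ → Matrix n n ℂ,
    IsSolution Lt s ρ → IsSolution Lt s σ → IsDensity (ρ s) → IsDensity (σ s) →
    traceNorm (ρ t - σ t) ≤ K * Real.exp (-γ * (t - s)) * traceNorm (ρ s - σ s)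

/-- Exponential contractivity of a time-dependent Lindbladian. -/
def ExpContractive (Lt : ℝ → Matrix n n ℂ → Matrix n n ℂ) : Prop :=
  ∃ K γ : ℝ, 0 < K ∧ 0 < γ ∧ ExpContractiveWith Lt K γ

/-- Time-dependent Hamiltonian: Hermitian values and continuous entries. -/
def IsHamiltonianFamily (H : ℝ → Matrix n n ℂ) : Prop :=
  (∀ t, (H t).IsHermitian) ∧ ∀ i j, Continuous fun t => H t i j

/-- Driven Lindbladian `x ↦ -i[H(t), x] + D(x)`. -/
noncomputable def driven {m : ℕ} (H : ℝ → Matrix n n ℂ) (L : Fin m → Matrix n n ℂ)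
    (t : ℝ) (x : Matrix n n ℂ) : Matrix n n ℂ :=
  hamTerm (H t) x + totalDissipator L x

/-- Hamiltonian-independent contractivity of a dissipator. -/
def HamIndepContractive {m : ℕ} (L : Fin m → Matrix n n ℂ) : Prop :=
  ∀ H : ℝ → Matrix n n ℂ, IsHamiltonianFamily H → ExpContractive (driven H L)

/-- The operator norm (largest singular value). -/
noncomputable def opNorm (A : Matrix n n ℂ) : ℝ :=
  ‖LinearMap.toContinuousLinearMap (Matrix.toEuclideanLin A)‖

end Paper

namespace Paper

open scoped Matrix.Norms.L2Operator Topology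
open Filter Set

section TraceNorm

variable {d : ℕ}

/-- Functional calculus through a unitary. -/
noncomputable def fc {A : Matrix (Fin d) (Fin d) ℂ} (hA : A.IsHermitian) (g : Fin d → ℝ) :
    Matrix (Fin d) (Fin d) ℂ :=
  (hA.eigenvectorUnitary : Matrix (Fin d) (Fin d) ℂ) * diagonal (fun i => (g i : ℂ)) *
    (hA.eigenvectorUnitary : Matrix (Fin d) (Fin d) ℂ)ᴴ

variable {A : Matrix (Fin d) (Fin d) ℂ} (hA : A.IsHermitian)

lemma unit_mul : (hA.eigenvectorUnitary : Matrix (Fin d) (Fin d) ℂ)ᴴ *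
    (hA.eigenvectorUnitary : Matrix (Fin d) (Fin d) ℂ) = 1 :=
  Unitary.coe_star_mul_self hA.eigenvectorUnitary

lemma mul_unit : (hA.eigenvectorUnitary : Matrix (Fin d) (Fin d) ℂ) *
    (hA.eigenvectorUnitary : Matrix (Fin d) (Fin d) ℂ)ᴴ = 1 :=
  Unitary.coe_mul_star_self hA.eigenvectorUnitary

lemma fc_eigen : fc hA hA.eigenvalues = A := by
  conv_rhs => rw [hA.spectral_theorem, Unitary.conjStarAlgAut_apply]
  rfl

lemma fc_one : fc hA (fun _ => 1) = 1 := by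
  simp [fc, mul_unit]

lemma fc_sub (f g : Fin d → ℝ) : fc hA f - fc hA g = fc hA (fun i => f i - g i) := by
  simp only [fc, ← sub_mul, ← mul_sub, diagonal_sub]
  simp

lemma fc_add (f g : Fin d → ℝ) : fc hA f + fc hA g = fc hA (fun i => f i + g i) := by
  simp only [fc, ← add_mul, ← mul_add, diagonal_add]
  simp

lemma fc_mul (f g : Fin d → ℝ) : fc hA f * fc hA g = fc hA (fun i => f i * g i) := by
  have : fc hA f * fc hA g = (hA.eigenvectorUnitary : Matrix (Fin d) (Fin d) ℂ) *
    (diagonal (fun i => (f i : ℂ)) * (((hA.eigenvectorUnitary : Matrix (Fin d) (Fin d) ℂ)ᴴ *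
      (hA.eigenvectorUnitary : Matrix (Fin d) (Fin d) ℂ)) * diagonal (fun i => (g i : ℂ)))) *
    (hA.eigenvectorUnitary : Matrix (Fin d) (Fin d) ℂ)ᴴ := by
      simp only [fc, mul_assoc]
  rw [this, unit_mul, one_mul, diagonal_mul_diagonal]
  simp [fc]

lemma fc_trace (f : Fin d → ℝ) : (fc hA f).trace.re = ∑ i, f i := by
  rw [fc, Matrix.trace_mul_comm, ← mul_assoc, unit_mul, one_mul, trace_diagonal]
  simp

lemma fc_psd (f : Fin d → ℝ) (hf : ∀ i, 0 ≤ f i) : (fc hA f).PosSemidef := by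
  refine PosSemidef.mul_mul_conjTranspose_same ?_ _
  refine PosSemidef.diagonal ?_
  intro i
  simpa using hf i

lemma traceNorm_eq : traceNorm A = ∑ i, |hA.eigenvalues i| := by
  set hB := (Matrix.posSemidef_conjTranspose_mul_self A).isHermitian with hBdef
  have h1 : (Aᴴ * A).charpoly = ∏ i, (Polynomial.X - Polynomial.C ((hA.eigenvalues i ^ 2 : ℝ) : ℂ)) := by
    have : Aᴴ * A = fc hA (fun i => hA.eigenvalues i ^ 2) := by
      rw [hA.eq]
      conv_lhs => rw [← fc_eigen hA, fc_mul]
      simp [sq]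
    rw [this, fc, charpoly_mul_comm, ← mul_assoc, unit_mul, one_mul, charpoly_diagonal]
  have h2 := hB.roots_charpoly_eq_eigenvalues
  rw [h1, Polynomial.roots_prod _ _
    (Finset.prod_ne_zero_iff.mpr fun i _ => Polynomial.X_sub_C_ne_zero _)] at h2
  have h3 := congrArg (fun M : Multiset ℂ => (M.map (fun z => Real.sqrt z.re)).sum) h2
  simp only [Polynomial.roots_X_sub_C, Multiset.bind_singleton, Multiset.map_map] at h3
  have h4 : ∀ i, Real.sqrt (hA.eigenvalues i ^ 2) = |hA.eigenvalues i| :=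
    fun i => Real.sqrt_sq_eq_abs _
  simp only [← h4]
  exact h3.symm

lemma trace_mul_nonneg {S P : Matrix (Fin d) (Fin d) ℂ} (hS : S.PosSemidef) (hP : P.PosSemidef) :
    0 ≤ (S * P).trace.re := by
  obtain ⟨R, hR⟩ : ∃ R : Matrix (Fin d) (Fin d) ℂ, P = Rᴴ * R := by
    refine ⟨fc hP.1 (fun i => Real.sqrt (hP.1.eigenvalues i)), ?_⟩
    rw [(fc_psd hP.1 _ (fun i => Real.sqrt_nonneg _)).1.eq, fc_mul]
    conv_lhs => rw [← fc_eigen hP.1]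
    congr 1
    ext i
    rw [Real.mul_self_sqrt (hP.eigenvalues_nonneg i)]
  rw [hR, ← mul_assoc, Matrix.trace_mul_comm, ← mul_assoc]
  have := (hS.mul_mul_conjTranspose_same R).trace_nonneg
  exact (Complex.le_def.mp this).1

lemma trace_re_nonneg {P : Matrix (Fin d) (Fin d) ℂ} (hP : P.PosSemidef) : 0 ≤ P.trace.re := 
  (Complex.le_def.mp hP.trace_nonneg).1

lemma exists_jordan (hA : A.IsHermitian) : ∃ P Q : Matrix (Fin d) (Fin d) ℂ, P.PosSemidef ∧ Q.PosSemidef ∧ A = P - Q ∧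
    P.trace.re + Q.trace.re = traceNorm A := by
  refine ⟨fc hA (fun i => max (hA.eigenvalues i) 0), fc hA (fun i => max (-hA.eigenvalues i) 0),
    fc_psd _ _ (fun i => le_max_right _ _), fc_psd _ _ (fun i => le_max_right _ _), ?_, ?_⟩
  · rw [fc_sub]
    conv_lhs => rw [← fc_eigen hA]
    congr 1
    ext i
    rcases le_total 0 (hA.eigenvalues i) with h | h <;> simp [h]
  · rw [fc_trace, fc_trace, traceNorm_eq hA, ← Finset.sum_add_distrib]
    refine Finset.sum_congr rfl fun i _ => ?_
    rcases le_total 0 (hA.eigenvalues i) with h | h <;> simp [h, abs_of_nonneg, abs_of_nonpos]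

/-- Duality. -/
lemma exists_dual0 (hA : A.IsHermitian) : ∃ X : Matrix (Fin d) (Fin d) ℂ, (X * A).trace.re = traceNorm A ∧
    ∀ P : Matrix (Fin d) (Fin d) ℂ, P.PosSemidef → |(X * P).trace.re| ≤ P.trace.re := by
  refine ⟨fc hA (fun i => if 0 ≤ hA.eigenvalues i then 1 else -1), ?_, ?_⟩
  · have : fc hA (fun i => if 0 ≤ hA.eigenvalues i then 1 else -1) * A =
        fc hA (fun i => |hA.eigenvalues i|) := by
      have h0 : ∀ f, fc hA f * A = fc hA f * fc hA hA.eigenvalues := by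
        intro f; rw [fc_eigen]
      rw [h0, fc_mul]
      congr 1
      ext i
      split_ifs with h
      · rw [abs_of_nonneg h, one_mul]
      · rw [abs_of_neg (not_le.mp h)]; ring
    rw [this, fc_trace, traceNorm_eq hA]
  · intro P hP
    have h1 : (1 - fc hA (fun i => if 0 ≤ hA.eigenvalues i then 1 else -1)).PosSemidef := by
      rw [← fc_one hA, fc_sub]
      refine fc_psd _ _ fun i => ?_
      split_ifs <;> norm_num
    have h2 : (1 + fc hA (fun i => if 0 ≤ hA.eigenvalues i then 1 else -1)).PosSemidef := by
      rw [← fc_one hA, fc_add]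
      refine fc_psd _ _ fun i => ?_
      split_ifs <;> norm_num
    have h3 := trace_mul_nonneg h1 hP
    have h4 := trace_mul_nonneg h2 hP
    rw [sub_mul, trace_sub, one_mul, Complex.sub_re] at h3
    rw [add_mul, trace_add, one_mul, Complex.add_re] at h4
    rw [abs_le]
    constructor <;> linarith

lemma traceNorm_le {P Q : Matrix (Fin d) (Fin d) ℂ} (hP : P.PosSemidef) (hQ : Q.PosSemidef) :
    traceNorm (P - Q) ≤ P.trace.re + Q.trace.re := by
  obtain ⟨X, h1, h2⟩ := exists_dual0 (hP.1.sub hQ.1)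
  rw [← h1, mul_sub, trace_sub, Complex.sub_re]
  have h3 := abs_le.mp (h2 P hP)
  have h4 := abs_le.mp (h2 Q hQ)
  linarith

lemma exists_dual (hA : A.IsHermitian) :
    ∃ X : Matrix (Fin d) (Fin d) ℂ, (X * A).trace.re = traceNorm A ∧
    ∀ B : Matrix (Fin d) (Fin d) ℂ, B.IsHermitian → (X * B).trace.re ≤ traceNorm B := by
  obtain ⟨X, h1, h2⟩ := exists_dual0 hA
  refine ⟨X, h1, fun B hB => ?_⟩
  obtain ⟨P, Q, hP, hQ, rfl, h⟩ := exists_jordan hB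
  rw [← h, mul_sub, trace_sub, Complex.sub_re]
  have h3 := abs_le.mp (h2 P hP)
  have h4 := abs_le.mp (h2 Q hQ)
  linarith

lemma traceNorm_nonneg (A : Matrix (Fin d) (Fin d) ℂ) : 0 ≤ traceNorm A :=
  Finset.sum_nonneg fun _ _ => Real.sqrt_nonneg _

lemma traceNorm_add_le {B : Matrix (Fin d) (Fin d) ℂ} (hA : A.IsHermitian) (hB : B.IsHermitian) :
    traceNorm (A + B) ≤ traceNorm A + traceNorm B := by
  obtain ⟨P, Q, hP, hQ, rfl, h⟩ := exists_jordan hA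
  obtain ⟨P', Q', hP', hQ', rfl, h'⟩ := exists_jordan hB
  have := traceNorm_le (hP.add hP') (hQ.add hQ')
  rw [trace_add, trace_add, Complex.add_re, Complex.add_re] at this
  rw [show P - Q + (P' - Q') = P + P' - (Q + Q') by abel]
  linarith

lemma traceNorm_smul_le {r : ℝ} (hr : 0 ≤ r) (hA : A.IsHermitian) :
    traceNorm ((r : ℂ) • A) ≤ r * traceNorm A := by
  obtain ⟨P, Q, hP, hQ, rfl, h⟩ := exists_jordan hA
  have hr' : (0 : ℂ) ≤ r := by exact_mod_cast hr
  have := traceNorm_le (hP.smul hr') (hQ.smul hr')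
  rw [smul_sub]
  refine this.trans ?_
  rw [← h]
  simp [mul_add]

lemma traceNorm_zero : traceNorm (0 : Matrix (Fin d) (Fin d) ℂ) = 0 := by
  refine le_antisymm ?_ (traceNorm_nonneg _)
  have := traceNorm_le (d := d) PosSemidef.zero PosSemidef.zero
  simpa using this

lemma psd_eq_zero {P : Matrix (Fin d) (Fin d) ℂ} (hP : P.PosSemidef) (h : P.trace.re ≤ 0) :
    P = 0 := by
  rw [← hP.trace_eq_zero_iff]
  apply Complex.ext
  · exact le_antisymm h (trace_re_nonneg hP)
  · exact (Complex.le_def.mp hP.trace_nonneg).2.symm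

lemma eq_zero_of_traceNorm (hA : A.IsHermitian) (h : traceNorm A ≤ 0) : A = 0 := by
  obtain ⟨P, Q, hP, hQ, rfl, h'⟩ := exists_jordan hA
  have h1 := trace_re_nonneg hP
  have h2 := trace_re_nonneg hQ
  rw [psd_eq_zero hP (by linarith), psd_eq_zero hQ (by linarith), sub_zero]

lemma abs_eig_le (i : Fin d) : |hA.eigenvalues i| ≤ ‖A‖ := by
  have h := spectrum.norm_le_norm_mul_of_mem (hA.eigenvalues_mem_spectrum_real i)
  have h1 : ‖(1 : Matrix (Fin d) (Fin d) ℂ)‖ ≤ 1 := by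
    rw [Matrix.cstar_norm_def, map_one]
    exact ContinuousLinearMap.norm_id_le
  rw [Real.norm_eq_abs] at h
  refine h.trans ?_
  exact mul_le_of_le_one_right (norm_nonneg _) h1

lemma traceNorm_le_norm (hA : A.IsHermitian) : traceNorm A ≤ d * ‖A‖ := by
  rw [traceNorm_eq hA]
  refine (Finset.sum_le_sum fun i _ => abs_eig_le hA i).trans ?_
  simp

lemma trace_conj_le {V P : Matrix (Fin d) (Fin d) ℂ} (hV : V.IsHermitian) {c : ℝ}
    (hc : ‖V‖ ≤ c) (hP : P.PosSemidef) : (V * P * V).trace.re ≤ c ^ 2 * P.trace.re := by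
  have h1 : (fc hV (fun i => c ^ 2 - hV.eigenvalues i * hV.eigenvalues i)).PosSemidef := by
    refine fc_psd _ _ fun i => ?_
    have := (abs_eig_le hV i).trans hc
    have h2 := abs_le.mp this
    nlinarith
  have h2 : fc hV (fun i => c ^ 2 - hV.eigenvalues i * hV.eigenvalues i) =
      ((c ^ 2 : ℝ) : ℂ) • 1 - V * V := by
    rw [← fc_sub, ← fc_mul, fc_eigen, ← fc_one hV]
    congr 1
    simp only [fc]
    rw [← smul_mul_assoc, ← mul_smul_comm, ← diagonal_smul]
    congr 3
    ext i
    simp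
  have h3 := trace_mul_nonneg h1 hP
  rw [h2, sub_mul, trace_sub, Complex.sub_re, smul_mul_assoc, one_mul, trace_smul, smul_eq_mul,
    Complex.re_ofReal_mul] at h3
  rw [Matrix.trace_mul_comm, ← mul_assoc]
  linarith

/-- The commutator bound. -/
lemma hamTerm_bound {V : Matrix (Fin d) (Fin d) ℂ} (hV : V.IsHermitian) {c : ℝ} (hc0 : 0 < c)
    (hc : ‖V‖ ≤ c) (hA : A.IsHermitian) : traceNorm (hamTerm V A) ≤ 2 * c * traceNorm A := by
  -- positive parts
  have key : ∀ P : Matrix (Fin d) (Fin d) ℂ, P.PosSemidef → ∃ P' Q' : Matrix (Fin d) (Fin d) ℂ,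
      P'.PosSemidef ∧ Q'.PosSemidef ∧ hamTerm V P = P' - Q' ∧
      P'.trace.re + Q'.trace.re ≤ 2 * c * P.trace.re := by
    intro P hP
    have hc' : (0 : ℂ) ≤ ((1 / (2 * c) : ℝ) : ℂ) := by
      have : 0 ≤ 1 / (2 * c) := by positivity
      exact_mod_cast this
    set Y : Matrix (Fin d) (Fin d) ℂ := (c : ℂ) • 1 - Complex.I • V with hY
    set Z : Matrix (Fin d) (Fin d) ℂ := (c : ℂ) • 1 + Complex.I • V with hZ
    have hYH : Yᴴ = Z := by
      rw [hY, hZ]; simp [conjTranspose_sub, conjTranspose_smul, hV.eq]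
    have hZH : Zᴴ = Y := by
      rw [← hYH, conjTranspose_conjTranspose]
    have e1 : Y * P * Z = ((c : ℂ) ^ 2) • P + (c : ℂ) • hamTerm V P + V * P * V := by
      rw [hY, hZ, hamTerm]
      simp only [sub_mul, mul_add, smul_mul_assoc, mul_smul_comm, one_mul, mul_one, smul_sub,
        smul_smul, neg_smul, smul_neg, Complex.I_mul_I, smul_add]
      module
    have e2 : Z * P * Y = ((c : ℂ) ^ 2) • P - (c : ℂ) • hamTerm V P + V * P * V := by
      rw [hY, hZ, hamTerm]
      simp only [add_mul, mul_sub, smul_mul_assoc, mul_smul_comm, one_mul, mul_one, smul_sub,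
        smul_smul, neg_smul, smul_neg, Complex.I_mul_I, smul_add]
      module
    refine ⟨((1 / (2 * c) : ℝ) : ℂ) • (Y * P * Z), ((1 / (2 * c) : ℝ) : ℂ) • (Z * P * Y), ?_, ?_, ?_, ?_⟩
    · rw [← hYH]; exact (hP.mul_mul_conjTranspose_same Y).smul hc'
    · rw [← hZH]; exact (hP.mul_mul_conjTranspose_same Z).smul hc'
    · rw [e1, e2]
      have hcc : (c : ℂ) ≠ 0 := by exact_mod_cast hc0.ne'
      have : ((1 / (2 * c) : ℝ) : ℂ) * (2 * c) = 1 := by push_cast; field_simp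
      rw [← smul_sub, show (c : ℂ) ^ 2 • P + (c : ℂ) • hamTerm V P + V * P * V -
        ((c : ℂ) ^ 2 • P - (c : ℂ) • hamTerm V P + V * P * V) = (2 * (c : ℂ)) • hamTerm V P by module,
        smul_smul, this, one_smul]
    · have hb := trace_conj_le hV hc hP
      rw [← Complex.add_re, ← trace_add, ← smul_add, e1, e2, trace_smul, smul_eq_mul,
        Complex.re_ofReal_mul, show (c : ℂ) ^ 2 • P + (c : ℂ) • hamTerm V P + V * P * V +
        ((c : ℂ) ^ 2 • P - (c : ℂ) • hamTerm V P + V * P * V) =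
          ((2 * c ^ 2 : ℝ) : ℂ) • P + ((2 : ℝ) : ℂ) • (V * P * V) by push_cast; module, trace_add,
        trace_smul, trace_smul, Complex.add_re, smul_eq_mul, smul_eq_mul, Complex.re_ofReal_mul,
        Complex.re_ofReal_mul, one_div, inv_mul_le_iff₀ (by positivity)]
      nlinarith
  obtain ⟨P, Q, hP, hQ, rfl, h⟩ := exists_jordan hA
  obtain ⟨P1, P2, h1, h2, h3, h4⟩ := key P hP
  obtain ⟨Q1, Q2, k1, k2, k3, k4⟩ := key Q hQ
  have e : hamTerm V (P - Q) = (P1 + Q2) - (P2 + Q1) := by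
    have : hamTerm V (P - Q) = hamTerm V P - hamTerm V Q := by
      simp only [hamTerm, mul_sub, sub_mul]
      module
    rw [this, h3, k3]; abel
  rw [e, ← h]
  refine (traceNorm_le (h1.add k2) (h2.add k1)).trans ?_
  rw [trace_add, trace_add, Complex.add_re, Complex.add_re]
  linarith

end TraceNorm

end Paper

namespace Paper

open scoped Matrix.Norms.L2Operator Topology
open Filter Set

section Dynamics

variable {d m : ℕ}

/-- The Lindbladian. -/
noncomputable def lind (L : Fin m → Matrix (Fin d) (Fin d) ℂ) (H x : Matrix (Fin d) (Fin d) ℂ) :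
    Matrix (Fin d) (Fin d) ℂ := hamTerm H x + totalDissipator L x

lemma hamTerm_trace (H x : Matrix (Fin d) (Fin d) ℂ) : (hamTerm H x).trace = 0 := by
  rw [hamTerm, trace_smul, trace_sub, Matrix.trace_mul_comm H x, sub_self, smul_zero]

lemma dissipator_trace (L x : Matrix (Fin d) (Fin d) ℂ) : (dissipator L x).trace = 0 := by
  rw [dissipator, trace_sub, trace_smul, trace_add, Matrix.trace_mul_comm x,
    Matrix.trace_mul_comm (L * x), ← mul_assoc, smul_eq_mul]
  ring

lemma lind_trace (L : Fin m → Matrix (Fin d) (Fin d) ℂ) (H x : Matrix (Fin d) (Fin d) ℂ) :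
    (lind L H x).trace = 0 := by
  rw [lind, trace_add, hamTerm_trace, totalDissipator, trace_sum]
  simp [dissipator_trace]

lemma hamTerm_conj {H : Matrix (Fin d) (Fin d) ℂ} (hH : H.IsHermitian)
    (x : Matrix (Fin d) (Fin d) ℂ) : (hamTerm H x)ᴴ = hamTerm H xᴴ := by
  simp only [hamTerm, conjTranspose_smul, conjTranspose_sub, conjTranspose_mul, hH.eq]
  simp only [star_neg, Complex.star_def, Complex.conj_I]
  module

lemma lind_conj (L : Fin m → Matrix (Fin d) (Fin d) ℂ) {H : Matrix (Fin d) (Fin d) ℂ}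
    (hH : H.IsHermitian) (x : Matrix (Fin d) (Fin d) ℂ) : (lind L H x)ᴴ = lind L H xᴴ := by
  rw [lind, lind, conjTranspose_add, hamTerm_conj hH, totalDissipator, totalDissipator,
    conjTranspose_sum]
  congr 1
  refine Finset.sum_congr rfl fun j _ => ?_
  simp only [dissipator, conjTranspose_smul, conjTranspose_sub, conjTranspose_mul,
    conjTranspose_add, conjTranspose_conjTranspose, mul_assoc]
  simp [add_comm]

/-- The Lindbladian as a linear map. -/
noncomputable def lindLM (L : Fin m → Matrix (Fin d) (Fin d) ℂ) (H : Matrix (Fin d) (Fin d) ℂ) :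
    Matrix (Fin d) (Fin d) ℂ →ₗ[ℂ] Matrix (Fin d) (Fin d) ℂ where
  toFun := lind L H
  map_add' x y := by
    simp only [lind, hamTerm, totalDissipator, dissipator, mul_add, add_mul]
    have : ∀ j, L j * x * (L j)ᴴ + L j * y * (L j)ᴴ - (1 / 2 : ℂ) • ((L j)ᴴ * L j * x +
        (L j)ᴴ * L j * y + (x * ((L j)ᴴ * L j) + y * ((L j)ᴴ * L j))) =
        (L j * x * (L j)ᴴ - (1 / 2 : ℂ) • ((L j)ᴴ * L j * x + x * ((L j)ᴴ * L j))) +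
        (L j * y * (L j)ᴴ - (1 / 2 : ℂ) • ((L j)ᴴ * L j * y + y * ((L j)ᴴ * L j))) := by
      intro j; module
    simp only [this, Finset.sum_add_distrib]
    module
  map_smul' r x := by
    simp only [lind, hamTerm, totalDissipator, dissipator, mul_smul_comm, smul_mul_assoc,
      RingHom.id_apply, smul_add, Finset.smul_sum]
    congr 1
    · module
    · refine Finset.sum_congr rfl fun j _ => ?_
      module

lemma lind_sub (L : Fin m → Matrix (Fin d) (Fin d) ℂ) (H x y : Matrix (Fin d) (Fin d) ℂ) :
    lind L H (x - y) = lind L H x - lind L H y := map_sub (lindLM L H) x y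

lemma lind_smul (L : Fin m → Matrix (Fin d) (Fin d) ℂ) (H x : Matrix (Fin d) (Fin d) ℂ) (r : ℂ) :
    lind L H (r • x) = r • lind L H x := map_smul (lindLM L H) r x

lemma step_identity (L : Fin m → Matrix (Fin d) (Fin d) ℂ) {H : Matrix (Fin d) (Fin d) ℂ}
    (hH : H.IsHermitian) : ∃ G : Matrix (Fin d) (Fin d) ℂ, ∀ (x : Matrix (Fin d) (Fin d) ℂ) (h : ℝ),
      x + (h : ℂ) • lind L H x = (1 - (h : ℂ) • G) * x * (1 - (h : ℂ) • G)ᴴ +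
        (h : ℂ) • ∑ j, L j * x * (L j)ᴴ - ((h : ℂ) ^ 2) • (G * x * Gᴴ) := by
  refine ⟨Complex.I • H + (1 / 2 : ℂ) • ∑ j, (L j)ᴴ * L j, fun x h => ?_⟩
  set M : Matrix (Fin d) (Fin d) ℂ := ∑ j, (L j)ᴴ * L j with hM
  have hMH : Mᴴ = M := by
    rw [hM, conjTranspose_sum]
    refine Finset.sum_congr rfl fun j _ => ?_
    simp [conjTranspose_mul]
  have e : totalDissipator L x = ∑ j, L j * x * (L j)ᴴ - (1 / 2 : ℂ) • (M * x + x * M) := by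
    simp only [totalDissipator, dissipator, hM, Finset.sum_sub_distrib, Finset.sum_mul,
      Finset.mul_sum, ← Finset.smul_sum, Finset.sum_add_distrib]
  have hG : (Complex.I • H + (1 / 2 : ℂ) • M)ᴴ = - Complex.I • H + (1 / 2 : ℂ) • M := by
    simp [conjTranspose_smul, hMH, hH.eq]
  rw [lind, e, conjTranspose_sub, conjTranspose_smul, hG, conjTranspose_one, hamTerm]
  generalize (∑ j, L j * x * (L j)ᴴ) = W
  simp only [Complex.star_def, Complex.conj_ofReal, sub_mul, mul_sub, one_mul, mul_one,
    smul_mul_assoc, mul_smul_comm, add_mul, mul_add, smul_add, smul_smul]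
  module

lemma dini_bound (L : Fin m → Matrix (Fin d) (Fin d) ℂ) {H x : Matrix (Fin d) (Fin d) ℂ}
    (hH : H.IsHermitian) (hx : x.IsHermitian) : ∃ C : ℝ, ∀ h : ℝ, 0 ≤ h →
      traceNorm (x + (h : ℂ) • lind L H x) ≤ traceNorm x + C * h ^ 2 := by
  obtain ⟨G, hG⟩ := step_identity L hH
  obtain ⟨P, Q, hP, hQ, rfl, hPQ⟩ := exists_jordan hx
  refine ⟨2 * ((G * P * Gᴴ).trace.re + (G * Q * Gᴴ).trace.re), fun h hh => ?_⟩
  have hh' : (0 : ℂ) ≤ h := by exact_mod_cast hh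
  have hh2 : (0 : ℂ) ≤ ((h ^ 2 : ℝ) : ℂ) := by
    have := sq_nonneg h
    exact_mod_cast this
  set Φ : Matrix (Fin d) (Fin d) ℂ → Matrix (Fin d) (Fin d) ℂ := fun x =>
    (1 - (h : ℂ) • G) * x * (1 - (h : ℂ) • G)ᴴ + (h : ℂ) • ∑ j, L j * x * (L j)ᴴ with hΦ
  have hG' : ∀ x, x + (h : ℂ) • lind L H x = Φ x - ((h ^ 2 : ℝ) : ℂ) • (G * x * Gᴴ) := by
    intro x; rw [hG x h, Complex.ofReal_pow]
  have hΦp : ∀ P : Matrix (Fin d) (Fin d) ℂ, P.PosSemidef → (Φ P).PosSemidef := by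
    intro P hP
    refine (hP.mul_mul_conjTranspose_same _).add (PosSemidef.smul ?_ hh')
    exact posSemidef_sum _ fun j _ => hP.mul_mul_conjTranspose_same _
  have hΦt : ∀ P : Matrix (Fin d) (Fin d) ℂ, (Φ P).trace.re =
      P.trace.re + h ^ 2 * (G * P * Gᴴ).trace.re := by
    intro P
    have : Φ P = P + (h : ℂ) • lind L H P + ((h ^ 2 : ℝ) : ℂ) • (G * P * Gᴴ) := by
      rw [hG']; abel
    rw [this, trace_add, trace_add, trace_smul, lind_trace, smul_zero, add_zero, Complex.add_re,
      trace_smul, smul_eq_mul, Complex.re_ofReal_mul]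
  have e : P - Q + (h : ℂ) • lind L H (P - Q) =
      (Φ P + ((h ^ 2 : ℝ) : ℂ) • (G * Q * Gᴴ)) - (Φ Q + ((h ^ 2 : ℝ) : ℂ) • (G * P * Gᴴ)) := by
    have h1 := hG' P
    have h2 := hG' Q
    rw [lind_sub, smul_sub, show P - Q + ((h : ℂ) • lind L H P - (h : ℂ) • lind L H Q) =
      (P + (h : ℂ) • lind L H P) - (Q + (h : ℂ) • lind L H Q) by abel, h1, h2]
    abel
  clear_value Φ
  rw [e]
  refine (traceNorm_le ((hΦp P hP).add ((hQ.mul_mul_conjTranspose_same G).smul hh2))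
    ((hΦp Q hQ).add ((hP.mul_mul_conjTranspose_same G).smul hh2))).trans ?_
  rw [trace_add, trace_add, Complex.add_re, Complex.add_re, hΦt, hΦt, trace_smul, trace_smul,
    smul_eq_mul, smul_eq_mul, Complex.re_ofReal_mul, Complex.re_ofReal_mul, ← hPQ]
  apply le_of_eq
  ring

lemma traceNorm_continuous_of {x : ℝ → Matrix (Fin d) (Fin d) ℂ} {s : Set ℝ}
    (hx : ContinuousOn x s) (hh : ∀ u ∈ s, (x u).IsHermitian) :
    ContinuousOn (fun u => traceNorm (x u)) s := by
  intro u hu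
  have h1 : Tendsto (fun z => (d : ℝ) * ‖x z - x u‖) (𝓝[s] u) (𝓝 0) := by
    have := (hx u hu).sub_const (x u) 
    have := (this.norm).const_mul (d : ℝ)
    simpa [ContinuousWithinAt] using this
  rw [ContinuousWithinAt, tendsto_iff_dist_tendsto_zero]
  refine squeeze_zero' (Eventually.of_forall fun _ => dist_nonneg) ?_ h1
  filter_upwards [self_mem_nhdsWithin] with z hz
  have a1 := traceNorm_add_le (hh u hu) ((hh z hz).sub (hh u hu))
  have a2 := traceNorm_add_le (hh z hz) ((hh u hu).sub (hh z hz))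
  have b1 := traceNorm_le_norm ((hh z hz).sub (hh u hu))
  have b2 := traceNorm_le_norm ((hh u hu).sub (hh z hz))
  rw [norm_sub_rev] at b2
  rw [add_sub_cancel] at a1 a2
  rw [Real.dist_eq, abs_le]
  constructor <;> linarith

lemma traceNorm_mono (L : Fin m → Matrix (Fin d) (Fin d) ℂ) {H x : ℝ → Matrix (Fin d) (Fin d) ℂ}
    (hH : ∀ t, (H t).IsHermitian) {a b : ℝ} (hab : a ≤ b)
    (hx : ∀ u ∈ Icc a b, HasDerivAt x (lind L (H u) (x u)) u)
    (hh : ∀ u ∈ Icc a b, (x u).IsHermitian) : traceNorm (x b) ≤ traceNorm (x a) := by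
  refine image_le_of_liminf_slope_right_le_deriv_boundary (f := fun u => traceNorm (x u))
    (B := fun _ => traceNorm (x a)) (B' := fun _ => 0)
    (traceNorm_continuous_of (fun u hu => (hx u hu).continuousAt.continuousWithinAt) hh)
    le_rfl continuousOn_const (fun u _ => hasDerivWithinAt_const _ _ _) ?_ (right_mem_Icc.mpr hab)
  intro u hu r hr
  have hu' : u ∈ Icc a b := Ico_subset_Icc_self hu
  obtain ⟨C, hC⟩ := dini_bound L (hH u) (hh u hu')
  apply Eventually.frequently
  have hd := (hx u hu')
  rw [hasDerivAt_iff_isLittleO] at hd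
  have hε : 0 < r / (2 * (d + 1)) := by positivity
  have h1 := (hd.def hε).filter_mono (nhdsWithin_le_nhds (s := Ioi u))
  have h2 : ∀ᶠ z in 𝓝[>] u, z < b := 
    (eventually_lt_nhds hu.2).filter_mono nhdsWithin_le_nhds
  have h3 : ∀ᶠ z in 𝓝[>] u, C * (z - u) < r / 2 := by
    have : Tendsto (fun z => C * (z - u)) (𝓝[>] u) (𝓝 0) := by
      have : Tendsto (fun z => C * (z - u)) (𝓝 u) (𝓝 (C * (u - u))) := by
        apply Continuous.tendsto; fun_prop
      rw [sub_self, mul_zero] at this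
      exact this.mono_left nhdsWithin_le_nhds
    exact this.eventually_lt_const (by linarith)
  filter_upwards [h1, h2, h3, self_mem_nhdsWithin] with z k1 k2 k3 k4
  have k4 : 0 < z - u := sub_pos.mpr k4
  have hz : z ∈ Icc a b := ⟨by linarith [hu.1], k2.le⟩
  rw [slope_def_field, div_lt_iff₀ k4]
  set R := x z - x u - (z - u) • lind L (H u) (x u) with hR
  have hcoe : (z - u) • lind L (H u) (x u) = ((z - u : ℝ) : ℂ) • lind L (H u) (x u) := rfl
  have hLH : (((z - u : ℝ) : ℂ) • lind L (H u) (x u)).IsHermitian := by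
    rw [IsHermitian, conjTranspose_smul, lind_conj L (hH u), (hh u hu').eq, Complex.star_def,
      Complex.conj_ofReal]
  have hRH : R.IsHermitian := by
    rw [hR, hcoe]
    exact ((hh z hz).sub (hh u hu')).sub hLH
  have e : x z = (x u + ((z - u : ℝ) : ℂ) • lind L (H u) (x u)) + R := by
    rw [hR, hcoe]; abel
  have l1 := traceNorm_add_le ((hh u hu').add hLH) hRH
  rw [← e] at l1
  have l2 := hC (z - u) k4.le
  have l3 := traceNorm_le_norm hRH
  rw [Real.norm_eq_abs, abs_of_pos k4] at k1
  have l4 : (d : ℝ) * ‖R‖ ≤ r / 2 * (z - u) := by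
    have : (d : ℝ) * ‖R‖ ≤ (d + 1) * (r / (2 * (d + 1)) * (z - u)) := by
      gcongr
      linarith
    refine this.trans (le_of_eq ?_)
    field_simp
  nlinarith

lemma herm_of_solution (L : Fin m → Matrix (Fin d) (Fin d) ℂ)
    {H x : ℝ → Matrix (Fin d) (Fin d) ℂ}
    (hH : ∀ t, (H t).IsHermitian) {a b : ℝ} (hab : a ≤ b)
    (hx : ∀ u ∈ Icc a b, HasDerivAt x (lind L (H u) (x u)) u)
    (ha : (x a).IsHermitian) : (x b).IsHermitian := by
  have key := traceNorm_mono L (H := H) (x := fun u => Complex.I • (x u - (x u)ᴴ)) hH hab ?_ ?_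
  · rw [ha.eq, sub_self, smul_zero, traceNorm_zero] at key
    have := eq_zero_of_traceNorm ?_ key
    · have := (smul_eq_zero.mp this).resolve_left Complex.I_ne_zero
      exact (sub_eq_zero.mp this).symm
    · rw [IsHermitian, conjTranspose_smul, conjTranspose_sub, conjTranspose_conjTranspose]
      simp only [Complex.star_def, Complex.conj_I]
      module
  · intro u hu
    have h1 := hx u hu
    have h2 := h1.star
    have h3 := (h1.sub h2).const_smul Complex.I
    rw [lind_smul, lind_sub, ← lind_conj L (hH u)]
    exact h3
  · intro u hu
    rw [IsHermitian, conjTranspose_smul, conjTranspose_sub, conjTranspose_conjTranspose]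
    simp only [Complex.star_def, Complex.conj_I]
    module

lemma trace_of_solution (L : Fin m → Matrix (Fin d) (Fin d) ℂ)
    {H x : ℝ → Matrix (Fin d) (Fin d) ℂ} {a b : ℝ} (hab : a ≤ b)
    (hx : ∀ u ∈ Icc a b, HasDerivAt x (lind L (H u) (x u)) u) : (x b).trace = (x a).trace := by
  have hd : ∀ u ∈ Icc a b, HasDerivAt (fun u => (x u).trace) 0 u := by
    intro u hu
    have := (LinearMap.toContinuousLinearMap ((Matrix.traceLinearMap (Fin d) ℂ ℂ).restrictScalars ℝ)).hasFDerivAt.comp_hasDerivAt u (hx u hu)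
    have e : LinearMap.toContinuousLinearMap ((Matrix.traceLinearMap (Fin d) ℂ ℂ).restrictScalars ℝ) (lind L (H u) (x u)) = 0 := lind_trace L _ _
    rw [e] at this
    exact this
  exact constant_of_has_deriv_right_zero (fun u hu => (hd u hu).continuousAt.continuousWithinAt)
    (fun u hu => (hd u (Ico_subset_Icc_self hu)).hasDerivWithinAt) b (right_mem_Icc.mpr hab)

lemma hasDerivAt_of_entries {x : ℝ → Matrix (Fin d) (Fin d) ℂ} {y : Matrix (Fin d) (Fin d) ℂ}
    {t : ℝ} (h : ∀ i j, HasDerivAt (fun u => x u i j) (y i j) t) : HasDerivAt x y t := by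
  have e : x = fun u => ∑ i, ∑ j, (x u i j) • Matrix.single i j (1 : ℂ) := by
    funext u
    conv_lhs => rw [Matrix.matrix_eq_sum_single (x u)]
    simp
  have e' : y = ∑ i, ∑ j, (y i j) • Matrix.single i j (1 : ℂ) := by
    conv_lhs => rw [Matrix.matrix_eq_sum_single y]
    simp
  rw [e, e']
  refine HasDerivAt.fun_sum fun i _ => HasDerivAt.fun_sum fun j _ => ?_
  exact (h i j).smul_const _

lemma entries_of_hasDerivAt {x : ℝ → Matrix (Fin d) (Fin d) ℂ} {y : Matrix (Fin d) (Fin d) ℂ}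
    {t : ℝ} (h : HasDerivAt x y t) (i j : Fin d) : HasDerivAt (fun u => x u i j) (y i j) t :=
  (LinearMap.toContinuousLinearMap
    ((Matrix.entryLinearMap ℂ ℂ i j).restrictScalars ℝ)).hasFDerivAt.comp_hasDerivAt t h

/-- Generator as a real continuous linear map. -/
noncomputable def gen (L : Fin m → Matrix (Fin d) (Fin d) ℂ) (H : Matrix (Fin d) (Fin d) ℂ) :
    Matrix (Fin d) (Fin d) ℂ →L[ℝ] Matrix (Fin d) (Fin d) ℂ :=
  LinearMap.toContinuousLinearMap ((lindLM L H).restrictScalars ℝ)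

lemma gen_apply (L : Fin m → Matrix (Fin d) (Fin d) ℂ) (H x : Matrix (Fin d) (Fin d) ℂ) :
    gen L H x = lind L H x := rfl

/-- Semigroup. -/
noncomputable def sg (L : Fin m → Matrix (Fin d) (Fin d) ℂ) (H : Matrix (Fin d) (Fin d) ℂ)
    (r : ℝ) : Matrix (Fin d) (Fin d) ℂ →L[ℝ] Matrix (Fin d) (Fin d) ℂ :=
  NormedSpace.exp (r • gen L H)

lemma sg_zero (L : Fin m → Matrix (Fin d) (Fin d) ℂ) (H x : Matrix (Fin d) (Fin d) ℂ) :
    sg L H 0 x = x := by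
  rw [sg, zero_smul ℝ (gen L H), NormedSpace.exp_zero]
  rfl

lemma sg_deriv (L : Fin m → Matrix (Fin d) (Fin d) ℂ) (H : Matrix (Fin d) (Fin d) ℂ) (r : ℝ) :
    HasDerivAt (sg L H) (sg L H r * gen L H) r :=
  hasDerivAt_exp_smul_const (gen L H) r

lemma sg_deriv' (L : Fin m → Matrix (Fin d) (Fin d) ℂ) (H : Matrix (Fin d) (Fin d) ℂ) (r : ℝ) :
    HasDerivAt (sg L H) (gen L H * sg L H r) r :=
  hasDerivAt_exp_smul_const' (gen L H) r

lemma sg_solution (L : Fin m → Matrix (Fin d) (Fin d) ℂ) (H x : Matrix (Fin d) (Fin d) ℂ) (r : ℝ) :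
    HasDerivAt (fun r => sg L H r x) (lind L H (sg L H r x)) r := by
  have := (sg_deriv' L H r).clm_apply (hasDerivAt_const r x)
  simpa [gen_apply] using this

lemma sg_herm (L : Fin m → Matrix (Fin d) (Fin d) ℂ) {H x : Matrix (Fin d) (Fin d) ℂ}
    (hH : H.IsHermitian) (hx : x.IsHermitian) {r : ℝ} (hr : 0 ≤ r) : (sg L H r x).IsHermitian :=
  herm_of_solution L (H := fun _ => H) (x := fun r => sg L H r x) (fun _ => hH) hr
    (fun u _ => sg_solution L H x u) (by simpa [sg_zero] using hx)

lemma sg_contr (L : Fin m → Matrix (Fin d) (Fin d) ℂ) {H x : Matrix (Fin d) (Fin d) ℂ}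
    (hH : H.IsHermitian) (hx : x.IsHermitian) {r : ℝ} (hr : 0 ≤ r) :
    traceNorm (sg L H r x) ≤ traceNorm x := by
  have := traceNorm_mono L (H := fun _ => H) (x := fun r => sg L H r x) (fun _ => hH) hr
    (fun u _ => sg_solution L H x u) (fun u hu => sg_herm L hH hx hu.1)
  simpa [sg_zero] using this

end Dynamics

end Paper

namespace Paper

open scoped Matrix.Norms.L2Operator Topology
open Filter Set

section Main

variable {d m : ℕ}

lemma sg_exp (L : Fin m → Matrix (Fin d) (Fin d) ℂ) {H0 : Matrix (Fin d) (Fin d) ℂ}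
    (hH0 : H0.IsHermitian) {K γ : ℝ} (hK : 0 < K)
    (hcontr : ExpContractiveWith (fun _ x => hamTerm H0 x + totalDissipator L x) K γ)
    {w : Matrix (Fin d) (Fin d) ℂ} (hw : w.IsHermitian) (htr : w.trace = 0) {r : ℝ} (hr : 0 ≤ r) :
    traceNorm (sg L H0 r w) ≤ K * Real.exp (-γ * r) * traceNorm w := by
  obtain ⟨P, Q, hP, hQ, hPQ, hn⟩ := exists_jordan hw
  have htr' : P.trace = Q.trace := by
    rw [hPQ, trace_sub] at htr
    exact sub_eq_zero.mp htr
  have hPre : P.trace = (P.trace.re : ℂ) :=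
    Complex.ext rfl (by simpa using (Complex.le_def.mp hP.trace_nonneg).2.symm)
  rcases (trace_re_nonneg hP).eq_or_lt with h0 | hpos
  · have hP0 := psd_eq_zero hP h0.symm.le
    have hQ0 := psd_eq_zero hQ (by rw [← htr']; exact h0.symm.le)
    rw [hPQ, hP0, hQ0, sub_zero, map_zero, traceNorm_zero, mul_zero]
  · set p := P.trace.re with hp
    have hpi : 0 ≤ p⁻¹ := by positivity
    have hpi' : (0 : ℂ) ≤ ((p⁻¹ : ℝ) : ℂ) := by exact_mod_cast hpi
    have hpc : (p : ℂ) ≠ 0 := by exact_mod_cast hpos.ne'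
    have h1 := hcontr 0 r le_rfl hr (fun u => sg L H0 u (((p⁻¹ : ℝ) : ℂ) • P))
      (fun u => sg L H0 u (((p⁻¹ : ℝ) : ℂ) • Q))
      (fun t _ => entries_of_hasDerivAt (sg_solution L H0 _ t))
      (fun t _ => entries_of_hasDerivAt (sg_solution L H0 _ t))
      ⟨by simp only [sg_zero]; exact hP.smul hpi', by
        simp only [sg_zero]; rw [trace_smul, hPre, smul_eq_mul]; push_cast; field_simp⟩
      ⟨by simp only [sg_zero]; exact hQ.smul hpi', by
        simp only [sg_zero]; rw [trace_smul, ← htr', hPre, smul_eq_mul]; push_cast; field_simp⟩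
    simp only [sg_zero, sub_zero] at h1
    rw [← map_sub, ← smul_sub, ← hPQ] at h1
    have h2 := traceNorm_smul_le hpi hw
    have hw' : (((p⁻¹ : ℝ) : ℂ) • w).IsHermitian := by
      rw [IsHermitian, conjTranspose_smul, hw.eq, Complex.star_def, Complex.conj_ofReal]
    have h3 := traceNorm_smul_le hpos.le (sg_herm L hH0 hw' hr)
    have e : (p : ℂ) • sg L H0 r (((p⁻¹ : ℝ) : ℂ) • w) = sg L H0 r w := by
      have e1 : (p : ℂ) • sg L H0 r (((p⁻¹ : ℝ) : ℂ) • w) =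
        sg L H0 r (p • (((p⁻¹ : ℝ) : ℂ) • w)) := ((sg L H0 r).map_smul p _).symm
      have e2 : p • (((p⁻¹ : ℝ) : ℂ) • w) = (p : ℂ) • (((p⁻¹ : ℝ) : ℂ) • w) := rfl
      rw [e1, e2, smul_smul]
      push_cast
      rw [mul_inv_cancel₀ hpc, one_smul]
    rw [e] at h3
    have hke : 0 ≤ K * Real.exp (-γ * r) := by positivity
    calc traceNorm (sg L H0 r w) ≤ p * traceNorm (sg L H0 r (((p⁻¹ : ℝ) : ℂ) • w)) := h3
      _ ≤ p * (K * Real.exp (-γ * r) * (p⁻¹ * traceNorm w)) := by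
        refine mul_le_mul_of_nonneg_left (h1.trans ?_) hpos.le
        exact mul_le_mul_of_nonneg_left h2 hke
      _ = K * Real.exp (-γ * r) * traceNorm w := by field_simp

/-- Scalar comparison. -/
lemma scalar_compare {g g' B B' : ℝ → ℝ} {a b : ℝ} (hab : a ≤ b)
    (hg : ∀ u ∈ Icc a b, HasDerivAt g (g' u) u) (hB : ∀ u, HasDerivAt B (B' u) u)
    (h : ∀ u ∈ Icc a b, g' u ≤ B' u) : g b - g a ≤ B b - B a := by
  have := image_le_of_deriv_right_le_deriv_boundary (f := g) (f' := g')
    (B := fun u => B u + (g a - B a)) (B' := B')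
    (fun u hu => (hg u hu).continuousAt.continuousWithinAt)
    (fun u hu => (hg u (Ico_subset_Icc_self hu)).hasDerivWithinAt)
    (by simp) (fun u _ => ((hB u).add_const _).continuousAt.continuousWithinAt)
    (fun u _ => ((hB u).add_const _).hasDerivWithinAt)
    (fun u hu => h u (Ico_subset_Icc_self hu)) (right_mem_Icc.mpr hab)
  linarith

lemma exp_duhamel {E : Type*} [NormedAddCommGroup E] [NormedSpace ℝ E] [CompleteSpace E]
    (A : E →L[ℝ] E) {x : ℝ → E} {x' : E} (t u : ℝ) (hx : HasDerivAt x x' u) :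
    HasDerivAt (fun u => NormedSpace.exp ((t - u) • A) (x u))
      (NormedSpace.exp ((t - u) • A) (x' - A (x u))) u := by
  have h0 : HasDerivAt (fun r : ℝ => NormedSpace.exp (r • A))
    (NormedSpace.exp ((t - u) • A) * A) (t - u) := hasDerivAt_exp_smul_const A (t - u)
  have h1 : HasDerivAt (fun u : ℝ => NormedSpace.exp ((t - u) • A))
      (-(NormedSpace.exp ((t - u) • A) * A)) u := by
    have := h0.scomp u ((hasDerivAt_id u).const_sub t)
    simpa [Function.comp_def] using this
  have h2 := h1.clm_apply hx
  refine h2.congr_deriv ?_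
  rw [map_sub]
  change -(NormedSpace.exp ((t - u) • A) (A (x u))) + _ = _
  abel

lemma duhamel_deriv (L : Fin m → Matrix (Fin d) (Fin d) ℂ) {H0 W : Matrix (Fin d) (Fin d) ℂ}
    {x : ℝ → Matrix (Fin d) (Fin d) ℂ} (t u : ℝ)
    (hx : HasDerivAt x (lind L (H0 + W) (x u)) u) :
    HasDerivAt (fun u => sg L H0 (t - u) (x u)) (sg L H0 (t - u) (hamTerm W (x u))) u := by
  have e : hamTerm W (x u) = lind L (H0 + W) (x u) - gen L H0 (x u) := by
    rw [gen_apply]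
    simp only [lind, hamTerm, add_mul, mul_add]
    module
  rw [e]
  exact exp_duhamel (gen L H0) t u hx

set_option maxHeartbeats 1000000 in
lemma step (L : Fin m → Matrix (Fin d) (Fin d) ℂ) {H0 : Matrix (Fin d) (Fin d) ℂ}
    (hH0 : H0.IsHermitian) {V x : ℝ → Matrix (Fin d) (Fin d) ℂ} (hV : ∀ t, (V t).IsHermitian)
    {K γ : ℝ} (hK : 1 ≤ K) (hγ : 0 < γ)
    (hcontr : ExpContractiveWith (fun _ x => hamTerm H0 x + totalDissipator L x) K γ)
    {c : ℝ} (hc0 : 0 < c) {s T : ℝ} (hbound : ∀ t, s ≤ t → ‖V t‖ ≤ c)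
    (hT : Real.log K / γ ≤ T)
    (hx : ∀ u, s ≤ u → HasDerivAt x (lind L (H0 + V u) (x u)) u)
    (hs : (x s).IsHermitian) (htr : (x s).trace = 0) :
    traceNorm (x (s + T)) ≤ (K * Real.exp (-γ * T) + 2 * c * (1 + Real.log K) / γ) *
      traceNorm (x s) := by
  have hlog : 0 ≤ Real.log K := Real.log_nonneg hK
  set a := Real.log K / γ with ha
  have ha0 : 0 ≤ a := by positivity
  have hHV : ∀ u, (H0 + V u).IsHermitian := fun u => hH0.add (hV u)
  have hherm : ∀ u, s ≤ u → (x u).IsHermitian := fun u hu =>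
    herm_of_solution L (H := fun u => H0 + V u) hHV hu (fun v hv => hx v hv.1) hs
  set F := traceNorm (x s) with hF
  have hF0 : 0 ≤ F := traceNorm_nonneg _
  have hmono : ∀ u, s ≤ u → traceNorm (x u) ≤ F := fun u hu =>
    traceNorm_mono L (H := fun u => H0 + V u) hHV hu (fun v hv => hx v hv.1)
      (fun v hv => hherm v hv.1)
  set t := s + T with ht
  set y : ℝ → Matrix (Fin d) (Fin d) ℂ := fun u => sg L H0 (t - u) (x u) with hy
  have hw : ∀ u, s ≤ u → (hamTerm (V u) (x u)).IsHermitian := by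
    intro u hu
    rw [IsHermitian, hamTerm_conj (hV u), (hherm u hu).eq]
  have hyd : ∀ u, s ≤ u → HasDerivAt y (sg L H0 (t - u) (hamTerm (V u) (x u))) u := by
    intro u hu
    exact duhamel_deriv L t u (hx u hu)
  have hyt : y t = x t := by simp only [hy, sub_self, sg_zero]
  have hst : s ≤ t := by rw [ht]; linarith
  obtain ⟨X, hX1, hX2⟩ := exists_dual (hherm t hst)
  set ℓ : Matrix (Fin d) (Fin d) ℂ →L[ℝ] ℝ := LinearMap.toContinuousLinearMap
    (Complex.reLm ∘ₗ ((Matrix.traceLinearMap (Fin d) ℂ ℂ).restrictScalars ℝ) ∘ₗ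
      ((LinearMap.mulLeft ℂ X).restrictScalars ℝ)) with hl
  have hlapp : ∀ z, ℓ z = (X * z).trace.re := fun z => rfl
  have hgd : ∀ u, s ≤ u → HasDerivAt (fun u => ℓ (y u))
      (ℓ (sg L H0 (t - u) (hamTerm (V u) (x u)))) u := fun u hu =>
    ℓ.hasFDerivAt.comp_hasDerivAt u (hyd u hu)
  have hwn : ∀ u, s ≤ u → traceNorm (hamTerm (V u) (x u)) ≤ 2 * c * F := fun u hu =>
    (hamTerm_bound (hV u) hc0 (hbound u hu) (hherm u hu)).trans
      (mul_le_mul_of_nonneg_left (hmono u hu) (by positivity))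
  have b1 : ∀ u ∈ Icc (t - a) t, ℓ (sg L H0 (t - u) (hamTerm (V u) (x u))) ≤ 2 * c * F := by
    intro u hu
    have hu0 : 0 ≤ t - u := by linarith [hu.2]
    have hsu : s ≤ u := by linarith [hu.1]
    rw [hlapp]
    refine (hX2 _ (sg_herm L hH0 (hw u hsu) hu0)).trans ?_
    exact (sg_contr L hH0 (hw u hsu) hu0).trans (hwn u hsu)
  have b2 : ∀ u ∈ Icc s (t - a), ℓ (sg L H0 (t - u) (hamTerm (V u) (x u))) ≤
      2 * c * F * K * Real.exp (-γ * (t - u)) := by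
    intro u hu
    have hu0 : 0 ≤ t - u := by linarith [hu.2]
    rw [hlapp]
    refine (hX2 _ (sg_herm L hH0 (hw u hu.1) hu0)).trans ?_
    refine (sg_exp L hH0 (by linarith) hcontr (hw u hu.1) (hamTerm_trace _ _) hu0).trans ?_
    have : 0 ≤ K * Real.exp (-γ * (t - u)) := by positivity
    nlinarith [mul_le_mul_of_nonneg_left (hwn u hu.1) this]
  have c1 := scalar_compare (B := fun u => 2 * c * F * u) (B' := fun _ => 2 * c * F)
    (by linarith : t - a ≤ t)
    (fun u hu => hgd u (by linarith [hu.1])) (fun u => by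
      simpa using (hasDerivAt_id u).const_mul (2 * c * F)) b1
  have c2 := scalar_compare (B := fun u => 2 * c * F * K / γ * Real.exp (-γ * (t - u)))
    (B' := fun u => 2 * c * F * K * Real.exp (-γ * (t - u)))
    (by linarith : s ≤ t - a)
    (fun u hu => hgd u hu.1) (fun u => by
      have h1 : HasDerivAt (fun u => -γ * (t - u)) γ u := by
        have := ((hasDerivAt_id u).const_sub t).const_mul (-γ)
        simpa using this
      have := h1.exp.const_mul (2 * c * F * K / γ)
      refine this.congr_deriv ?_
      field_simp) b2
  have e1 : K * Real.exp (-γ * (t - (t - a))) = 1 := by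
    have : -γ * (t - (t - a)) = - Real.log K := by
      rw [ha]; field_simp; ring
    rw [this, Real.exp_neg, Real.exp_log (by linarith), mul_inv_cancel₀ (by linarith)]
  have e2 : 2 * c * F * K / γ * Real.exp (-γ * (t - (t - a))) = 2 * c * F / γ := by
    rw [show 2 * c * F * K / γ * Real.exp (-γ * (t - (t - a))) =
      2 * c * F / γ * (K * Real.exp (-γ * (t - (t - a)))) by ring, e1, mul_one]
  have e3 : 0 ≤ 2 * c * F * K / γ * Real.exp (-γ * (t - s)) := by
    have : 0 ≤ K := by linarith
    positivity
  have e4 : ℓ (y t) = traceNorm (x t) := by rw [hlapp, hyt, hX1]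
  have hts : t - s = T := by rw [ht]; ring
  have hT0 : 0 ≤ t - s := by linarith
  have e5 : ℓ (y s) ≤ K * Real.exp (-γ * T) * F := by
    rw [hlapp]
    refine (hX2 _ (sg_herm L hH0 hs hT0)).trans ?_
    rw [← hts]
    exact sg_exp L hH0 (by linarith) hcontr hs htr hT0
  have e6 : 2 * c * F / γ + 2 * c * F * a = 2 * c * (1 + Real.log K) / γ * F := by
    rw [ha]; field_simp
  rw [e2] at c2
  nlinarith

end Main

end Paper

namespace Paper

open scoped Matrix.Norms.L2Operator Topology
open Filter Set

lemma solution_diff {d m : ℕ} (L : Fin m → Matrix (Fin d) (Fin d) ℂ)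
    {H ρ σ : ℝ → Matrix (Fin d) (Fin d) ℂ} {s : ℝ} (hρ : IsSolution (driven H L) s ρ)
    (hσ : IsSolution (driven H L) s σ) (u : ℝ) (hu : s ≤ u) :
    HasDerivAt (fun u => ρ u - σ u) (lind L (H u) (ρ u - σ u)) u := by
  rw [lind_sub]
  exact (hasDerivAt_of_entries (hρ u hu)).fun_sub (hasDerivAt_of_entries (hσ u hu))

lemma decay_iterate {f : ℝ → ℝ} {s t q T : ℝ} (hq0 : 0 < q) (hq1 : q < 1) (hT : 0 < T)
    (hst : s ≤ t) (hf0 : 0 ≤ f s) (hmono : ∀ a b, s ≤ a → a ≤ b → f b ≤ f a)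
    (hstep : ∀ a, s ≤ a → f (a + T) ≤ q * f a) :
    f t ≤ q⁻¹ * Real.exp (-(-Real.log q / T) * (t - s)) * f s := by
  have hiter : ∀ n : ℕ, f (s + n * T) ≤ q ^ n * f s := by
    intro n
    induction n with
    | zero => simp
    | succ k ih =>
      have h1 := hstep (s + k * T) (by have : 0 ≤ (k : ℝ) * T := by positivity
                                       linarith)
      rw [show s + ((k + 1 : ℕ) : ℝ) * T = s + k * T + T by push_cast; ring, pow_succ]
      nlinarith
  have hr0 : 0 ≤ (t - s) / T := div_nonneg (by linarith) hT.le
  set n := ⌊(t - s) / T⌋₊ with hn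
  have h1 : (n : ℝ) ≤ (t - s) / T := Nat.floor_le hr0
  have h2 : (t - s) / T < n + 1 := Nat.lt_floor_add_one _
  have h3 : (n : ℝ) * T ≤ t - s := by rwa [le_div_iff₀ hT] at h1
  have h4 : f t ≤ q ^ n * f s :=
    (hmono (s + n * T) t (by have : 0 ≤ (n : ℝ) * T := by positivity
                             linarith) (by linarith)).trans (hiter n)
  refine h4.trans (mul_le_mul_of_nonneg_right ?_ hf0)
  have hlq : Real.log q < 0 := Real.log_neg hq0 hq1
  have e : q⁻¹ * Real.exp (-(-Real.log q / T) * (t - s)) =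
      Real.exp (Real.log q * ((t - s) / T - 1)) := by
    rw [mul_sub (Real.log q), mul_one, Real.exp_sub, Real.exp_log hq0, div_eq_mul_inv, mul_comm]
    congr 2
    field_simp
  have e' : q ^ n = Real.exp (Real.log q * n) := by
    rw [mul_comm, Real.exp_nat_mul, Real.exp_log hq0]
  rw [e, e', Real.exp_le_exp]
  nlinarith

end Paper

namespace Paper

/-- a sufficiently small time-dependent Hermitian perturbation `V(t)` of the
Hamiltonian of an exponentially contractive constant Lindbladian leaves the driven
Lindbladian exponentially contractive. -/
theorem small_drive_contractive {d m : ℕ}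
    (L : Fin m → Matrix (Fin d) (Fin d) ℂ)
    (H0 : Matrix (Fin d) (Fin d) ℂ) (hH0 : H0.IsHermitian)
    (V : ℝ → Matrix (Fin d) (Fin d) ℂ)
    (hVherm : ∀ t, (V t).IsHermitian)
    (hVcont : ∀ i j, Continuous fun t => V t i j)
    (K γ : ℝ) (hK : 0 < K) (hγ : 0 < γ)
    (hcontr : ExpContractiveWith (fun _ x => hamTerm H0 x + totalDissipator L x) K γ)
    -- `sup_{t ≥ 0} ‖V(t)‖_∞ < γ / (2 + 2 ln K)`, expressed via an upper bound `c`: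
    (c : ℝ) (hbound : ∀ t, 0 ≤ t → opNorm (V t) ≤ c)
    (hc : c < γ / (2 + 2 * Real.log K)) :
    ExpContractive (driven (fun t => H0 + V t) L) := by
  have hc0 : 0 ≤ c := (norm_nonneg _).trans (hbound 0 le_rfl)
  have hden : 0 < 2 + 2 * Real.log K := by
    by_contra h
    have := div_nonpos_of_nonneg_of_nonpos hγ.le (not_lt.mp h)
    linarith
  have hHV : ∀ u, (H0 + V u).IsHermitian := fun u => hH0.add (hVherm u)
  rcases lt_or_ge K 1 with hK1 | hK1
  · refine ⟨1, 1, one_pos, one_pos, ?_⟩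
    intro s t hs hst ρ σ hρ hσ dρ dσ
    have hx := solution_diff L hρ hσ
    have hxs : (ρ s - σ s).IsHermitian := dρ.1.1.sub dσ.1.1
    have htr : (ρ s - σ s).trace = 0 := by rw [trace_sub, dρ.2, dσ.2, sub_self]
    have h1 := sg_exp L hH0 hK hcontr hxs htr le_rfl
    rw [sg_zero, mul_zero, Real.exp_zero, mul_one] at h1
    have h2 := traceNorm_nonneg (ρ s - σ s)
    have h3 : traceNorm (ρ s - σ s) = 0 := by nlinarith
    have h4 := traceNorm_mono L (H := fun u => H0 + V u) (x := fun u => ρ u - σ u) hHV hst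
      (fun u hu => hx u hu.1) (fun u hu => herm_of_solution L (H := fun u => H0 + V u)
        (x := fun u => ρ u - σ u) hHV hu.1 (fun v hv => hx v hv.1) hxs)
    rw [h3, mul_zero]
    rw [h3] at h4
    exact h4
  · obtain ⟨c', hcc', hc'⟩ := exists_between hc
    have hc'0 : 0 < c' := by linarith
    have hlog : 0 ≤ Real.log K := Real.log_nonneg hK1
    have hq : 2 * c' * (1 + Real.log K) / γ < 1 := by
      rw [lt_div_iff₀ hden] at hc'
      rw [div_lt_one hγ]
      linarith
    have hlim : Filter.Tendsto (fun T : ℝ => K * Real.exp (-γ * T) +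
        2 * c' * (1 + Real.log K) / γ) Filter.atTop
        (nhds (K * 0 + 2 * c' * (1 + Real.log K) / γ)) := by
      refine Filter.Tendsto.add_const _ (Filter.Tendsto.const_mul _ ?_)
      refine Real.tendsto_exp_atBot.comp ?_
      exact Filter.tendsto_id.const_mul_atTop_of_neg (by linarith)
    rw [mul_zero, zero_add] at hlim
    obtain ⟨T, hT1, hT2, hT3⟩ := ((hlim.eventually_lt_const hq).and
      ((Filter.eventually_ge_atTop (Real.log K / γ)).and (Filter.eventually_gt_atTop 0))).exists
    set q := K * Real.exp (-γ * T) + 2 * c' * (1 + Real.log K) / γ with hqdef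
    have hq0 : 0 < q := by positivity
    refine ⟨q⁻¹, -Real.log q / T, by positivity,
      div_pos (neg_pos.mpr (Real.log_neg hq0 hT1)) hT3, ?_⟩
    intro s t hs hst ρ σ hρ hσ dρ dσ
    have hx := solution_diff L hρ hσ
    have hxs : (ρ s - σ s).IsHermitian := dρ.1.1.sub dσ.1.1
    have htr : (ρ s - σ s).trace = 0 := by rw [trace_sub, dρ.2, dσ.2, sub_self]
    have hherm : ∀ u, s ≤ u → (ρ u - σ u).IsHermitian := fun u hu =>
      herm_of_solution L (H := fun u => H0 + V u) (x := fun u => ρ u - σ u) hHV hu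
        (fun v hv => hx v hv.1) hxs
    have htrace : ∀ u, s ≤ u → (ρ u - σ u).trace = 0 := fun u hu =>
      (trace_of_solution L (H := fun u => H0 + V u) (x := fun u => ρ u - σ u) hu
        (fun v hv => hx v hv.1)).trans htr
    refine decay_iterate (f := fun u => traceNorm (ρ u - σ u)) hq0 hT1 hT3 hst
      (traceNorm_nonneg _) ?_ ?_
    · intro a b ha hab
      exact traceNorm_mono L (H := fun u => H0 + V u) (x := fun u => ρ u - σ u) hHV hab
        (fun u hu => hx u (ha.trans hu.1)) (fun u hu => hherm u (ha.trans hu.1))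
    · intro a ha
      exact step L hH0 (x := fun u => ρ u - σ u) hVherm hK1 hγ hcontr hc'0
        (fun u hu => (hbound u (hs.trans (ha.trans hu))).trans hcc'.le) hT2
        (fun u hu => hx u (ha.trans hu)) (hherm a ha) (htrace a ha)

end Paper
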